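/- arXiv:2111.02921 — 7 statements merged into one kernel-verified Lean document; each statement's English description precedes it below -/
import Mathlib

section
/- Let U ≥ 1, let H₁, H₂ ∈ ℂ^{U×U}, let α > 0 and set ΔH = H₂ − α·H₁. Let C₁, C₂ ⊆ ℂ^U be finite sets, each with at least two elements, such that d_min(α·H₁, C₁) ≥ d_min(α·H₁, C₂) (i.e., C₁ is at least as good as C₂ for the channel α·H₁) and d_min(H₂, C₂) > 0. Let (x₁, x̃₁) be a pair of distinct points of C₂ attaining d_min(α·H₁, C₂), let (y₂, ỹ₂) be a pair of distinct points of C₁ attaining d_min(H₂, C₁), and let (x₂, x̃₂) be a pair of distinct points of C₂ attaining d_min(H₂, C₂). Then 1 − d_min(H₂, C₁)/d_min(H₂, C₂) ≤ ‖ΔH‖_F · (‖x₁ − x̃₁‖₂ + ‖y₂ − ỹ₂‖₂) / ‖H₂(x₂ − x̃₂)‖₂. -/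
open scoped BigOperators

/-- Euclidean norm of a complex vector. -/
noncomputable def euclNorm {U : ℕ} (v : Fin U → ℂ) : ℝ :=
  Real.sqrt (∑ i, ‖v i‖ ^ 2)

/-- Frobenius norm of a complex matrix. -/
noncomputable def frobNorm {U : ℕ} (M : Matrix (Fin U) (Fin U) ℂ) : ℝ :=
  Real.sqrt (∑ i, ∑ j, ‖M i j‖ ^ 2)

/-- Minimum Euclidean distance of a constellation `C` under channel matrix `M`. -/
noncomputable def dmin {U : ℕ} (M : Matrix (Fin U) (Fin U) ℂ) (C : Finset (Fin U → ℂ)) : ℝ :=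
  sInf {d : ℝ | ∃ x ∈ C, ∃ y ∈ C, x ≠ y ∧ d = euclNorm (M.mulVec (x - y))}

theorem aux_euclNorm_eq {U : ℕ} (v : Fin U → ℂ) : euclNorm v = ‖WithLp.toLp 2 v‖ := by
  rw [EuclideanSpace.norm_eq]; rfl

theorem aux_euclNorm_add {U : ℕ} (v w : Fin U → ℂ) :
    euclNorm (v + w) ≤ euclNorm v + euclNorm w := by
  simp only [aux_euclNorm_eq, WithLp.toLp_add]
  exact norm_add_le _ _

theorem aux_euclNorm_neg {U : ℕ} (v : Fin U → ℂ) : euclNorm (-v) = euclNorm v := by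
  simp [euclNorm]

theorem aux_mulVec_le {U : ℕ} (M : Matrix (Fin U) (Fin U) ℂ) (v : Fin U → ℂ) :
    euclNorm (M.mulVec v) ≤ frobNorm M * euclNorm v := by
  unfold euclNorm frobNorm
  rw [← Real.sqrt_mul (by positivity)]
  apply Real.sqrt_le_sqrt
  rw [Finset.sum_mul]
  apply Finset.sum_le_sum
  intro i _
  have h1 : ‖M.mulVec v i‖ ≤ ∑ j, ‖M i j‖ * ‖v j‖ := by
    simp only [Matrix.mulVec, dotProduct]
    refine (norm_sum_le _ _).trans (le_of_eq ?_)
    simp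
  calc ‖M.mulVec v i‖ ^ 2 ≤ (∑ j, ‖M i j‖ * ‖v j‖) ^ 2 := by gcongr
    _ ≤ _ := Finset.sum_mul_sq_le_sq_mul_sq _ _ _

theorem aux_dmin_le {U : ℕ} (M : Matrix (Fin U) (Fin U) ℂ) (C : Finset (Fin U → ℂ))
    (x y : Fin U → ℂ) (hx : x ∈ C) (hy : y ∈ C) (hne : x ≠ y) :
    dmin M C ≤ euclNorm (M.mulVec (x - y)) := by
  apply csInf_le
  · refine ⟨0, ?_⟩
    rintro d ⟨x, _, y, _, _, rfl⟩
    exact Real.sqrt_nonneg _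
  · exact ⟨x, hx, y, hy, hne, rfl⟩

/-- Theorem 1: the normalized MED loss from using, under channel `H₂`, a constellation `C₁`
optimal for the proportional channel `α • H₁`, is bounded by `‖ΔH‖_F` times a finite factor. -/
theorem dmin_diff_nonuniform_linkgain
    (U : ℕ) (hU : 1 ≤ U)
    (H₁ H₂ ΔH : Matrix (Fin U) (Fin U) ℂ) (α : ℝ) (hα : 0 < α)
    (hΔH : ΔH = H₂ - (α : ℂ) • H₁)
    (C₁ C₂ : Finset (Fin U → ℂ))
    (hC₁ : 2 ≤ C₁.card) (hC₂ : 2 ≤ C₂.card)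
    (hopt : dmin ((α : ℂ) • H₁) C₂ ≤ dmin ((α : ℂ) • H₁) C₁)
    (hpos : 0 < dmin H₂ C₂)
    -- `(x₁, x₁')` attains `dmin(α•H₁, C₂)`
    (x₁ x₁' : Fin U → ℂ) (hx₁ : x₁ ∈ C₂) (hx₁' : x₁' ∈ C₂) (hx₁ne : x₁ ≠ x₁')
    (hx₁att : euclNorm (((α : ℂ) • H₁).mulVec (x₁ - x₁')) = dmin ((α : ℂ) • H₁) C₂)
    -- `(y₂, y₂')` attains `dmin(H₂, C₁)`
    (y₂ y₂' : Fin U → ℂ) (hy₂ : y₂ ∈ C₁) (hy₂' : y₂' ∈ C₁) (hy₂ne : y₂ ≠ y₂')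
    (hy₂att : euclNorm (H₂.mulVec (y₂ - y₂')) = dmin H₂ C₁)
    -- `(x₂, x₂')` attains `dmin(H₂, C₂)`
    (x₂ x₂' : Fin U → ℂ) (hx₂ : x₂ ∈ C₂) (hx₂' : x₂' ∈ C₂) (hx₂ne : x₂ ≠ x₂')
    (hx₂att : euclNorm (H₂.mulVec (x₂ - x₂')) = dmin H₂ C₂) :
    1 - dmin H₂ C₁ / dmin H₂ C₂ ≤
      frobNorm ΔH * (euclNorm (x₁ - x₁') + euclNorm (y₂ - y₂')) /
        euclNorm (H₂.mulVec (x₂ - x₂')) := by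
  have h1 := aux_dmin_le H₂ C₂ x₁ x₁' hx₁ hx₁' hx₁ne
  have h2 := aux_dmin_le ((α : ℂ) • H₁) C₁ y₂ y₂' hy₂ hy₂' hy₂ne
  have h3 : euclNorm (H₂.mulVec (x₁ - x₁')) ≤
      euclNorm (((α : ℂ) • H₁).mulVec (x₁ - x₁')) + frobNorm ΔH * euclNorm (x₁ - x₁') := by
    have e : H₂.mulVec (x₁ - x₁') =
        ((α : ℂ) • H₁).mulVec (x₁ - x₁') + ΔH.mulVec (x₁ - x₁') := by
      rw [← Matrix.add_mulVec, hΔH, add_sub_cancel]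
    rw [e]
    exact (aux_euclNorm_add _ _).trans (add_le_add le_rfl (aux_mulVec_le _ _))
  have h4 : euclNorm (((α : ℂ) • H₁).mulVec (y₂ - y₂')) ≤
      euclNorm (H₂.mulVec (y₂ - y₂')) + frobNorm ΔH * euclNorm (y₂ - y₂') := by
    have e : ((α : ℂ) • H₁).mulVec (y₂ - y₂') =
        H₂.mulVec (y₂ - y₂') + -(ΔH.mulVec (y₂ - y₂')) := by
      rw [hΔH, Matrix.sub_mulVec]; abel
    rw [e]
    refine (aux_euclNorm_add _ _).trans (add_le_add le_rfl ?_)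
    rw [aux_euclNorm_neg]
    exact aux_mulVec_le _ _
  rw [hx₂att, one_sub_div hpos.ne']
  apply div_le_div_of_nonneg_right _ hpos.le
  linarith
end

section
/- Fix z_R > 0, a reference wavelength λ_a > 0 and a nonzero reference mode l_m ∈ ℤ. For every wavelength λ_i > 0, every nonzero mode l ∈ ℤ, every z > 0 and every β > 0, the link gain at radius r = β·r_max(λ_a, l_m, z) satisfies the exact identity g(λ_i, l, β·r_max(λ_a, l_m, z), z) = (λ_i² / ((4π)²·d_m(λ_i, l, z)²)) · (λ_a·|l_m| / (λ_i·|l|))^{|l|} · β^{2|l|} · e^{|l|} · exp(−β²·λ_a·|l_m| / λ_i). -/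
open scoped BigOperators

/-- Squared beam waist: `ω(λ)² = λ·z_R/π`. -/
noncomputable def waistSq (zR lam : ℝ) : ℝ := lam * zR / Real.pi

/-- Squared beam spot at axial distance `z`: `ω(λ,z)² = ω(λ)²·(1 + z²/z_R²)`. -/
noncomputable def spotSq (zR lam z : ℝ) : ℝ := waistSq zR lam * (1 + z ^ 2 / zR ^ 2)

/-- Maximum-strength radius `r_max(λ,l,z) = √(|l|/2)·ω(λ,z)`. -/
noncomputable def rmax (zR lam : ℝ) (l : ℤ) (z : ℝ) : ℝ :=
  Real.sqrt ((l.natAbs : ℝ) / 2 * spotSq zR lam z)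

/-- `d_m(λ,l,z) = √(r_max(λ,l,z)² + z²)`; in particular `d_m(λ,0,z) = z` for `z > 0`. -/
noncomputable def dm (zR lam : ℝ) (l : ℤ) (z : ℝ) : ℝ :=
  Real.sqrt (rmax zR lam l z ^ 2 + z ^ 2)

/-- OAM link gain at radius `r` and axial distance `z` (Equation (2) of the paper). -/
noncomputable def gain (zR lam : ℝ) (l : ℤ) (r z : ℝ) : ℝ :=
  if l = 0 then
    lam ^ 2 / ((4 * Real.pi) ^ 2 * z ^ 2) * Real.exp (-2 * r ^ 2 / spotSq zR lam z)
  else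
    lam ^ 2 / ((4 * Real.pi) ^ 2 * dm zR lam l z ^ 2) *
      (r / rmax zR lam l z) ^ (2 * l.natAbs) *
      Real.exp (2 * (rmax zR lam l z ^ 2 - r ^ 2) / spotSq zR lam z)

/-- Equation (13): exact separation of the `β` and `z` dependence of the link gain at radius
`r = β·r_max(λ_a, l_m, z)`. -/
theorem gain_beta_form
    (zR lamA : ℝ) (lm : ℤ) (hzR : 0 < zR) (hlamA : 0 < lamA) (hlm : lm ≠ 0)
    (lamI : ℝ) (hlamI : 0 < lamI) (l : ℤ) (hl : l ≠ 0)
    (z β : ℝ) (hz : 0 < z) (hβ : 0 < β) :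
    gain zR lamI l (β * rmax zR lamA lm z) z =
      lamI ^ 2 / ((4 * Real.pi) ^ 2 * dm zR lamI l z ^ 2) *
        (lamA * (lm.natAbs : ℝ) / (lamI * (l.natAbs : ℝ))) ^ l.natAbs *
        β ^ (2 * l.natAbs) * Real.exp (l.natAbs : ℝ) *
        Real.exp (-(β ^ 2) * lamA * (lm.natAbs : ℝ) / lamI) := by
  have hk : 0 < zR / Real.pi * (1 + z ^ 2 / zR ^ 2) := by
    have := Real.pi_pos
    positivity
  have hs : ∀ lam, spotSq zR lam z = lam * (zR / Real.pi * (1 + z ^ 2 / zR ^ 2)) := by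
    intro lam
    unfold spotSq waistSq
    ring
  have hr : ∀ lam, 0 < lam → ∀ m : ℤ, rmax zR lam m z ^ 2 =
      (m.natAbs : ℝ) / 2 * (lam * (zR / Real.pi * (1 + z ^ 2 / zR ^ 2))) := by
    intro lam hlam m
    unfold rmax
    rw [hs, Real.sq_sqrt (by positivity)]
  generalize zR / Real.pi * (1 + z ^ 2 / zR ^ 2) = k at hk hs hr
  have hn : (0 : ℝ) < (l.natAbs : ℝ) := by
    exact_mod_cast Int.natAbs_pos.mpr hl
  have hbase : (β * rmax zR lamA lm z / rmax zR lamI l z) ^ (2 * l.natAbs) =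
      (lamA * (lm.natAbs : ℝ) / (lamI * (l.natAbs : ℝ))) ^ l.natAbs * β ^ (2 * l.natAbs) := by
    rw [pow_mul, pow_mul, ← mul_pow, div_pow, mul_pow, hr lamA hlamA, hr lamI hlamI]
    congr 1
    field_simp
  have hexp : 2 * (rmax zR lamI l z ^ 2 - (β * rmax zR lamA lm z) ^ 2) / spotSq zR lamI z =
      (l.natAbs : ℝ) + -(β ^ 2) * lamA * (lm.natAbs : ℝ) / lamI := by
    rw [mul_pow, hr lamA hlamA, hr lamI hlamI, hs]
    field_simp
    ring
  unfold gain
  rw [if_neg hl, hbase, hexp, Real.exp_add]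
  ring
end

section
/- Fix z_R > 0, λ_a > 0 and a nonzero mode l_m ∈ ℤ. For wavelengths λ_i, λ_j > 0, a mode l ∈ ℤ, z > 0 and β > 0, the link gain ratio between the two sub-channels with the same mode l at the position (β·r_max(λ_a, l_m, z), z) satisfies the exact identity g(λ_i, l, β·r_max(λ_a, l_m, z), z) / g(λ_j, l, β·r_max(λ_a, l_m, z), z) = (λ_j/λ_i)^{|l|−2} · [ (ω(λ_j)²·(|l|/2)·(1 + z²/z_R²) + z²) / (ω(λ_i)²·(|l|/2)·(1 + z²/z_R²) + z²) ] · exp( β²·|l_m|·λ_a·(λ_i − λ_j)/(λ_i·λ_j) ). -/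
open scoped BigOperators

lemma spot_pos_aux (zR lam z : ℝ) (hzR : 0 < zR) (hlam : 0 < lam) : 0 < spotSq zR lam z := by
  unfold spotSq waistSq
  have := Real.pi_pos
  positivity

lemma rmax_sq_aux (zR lam : ℝ) (l : ℤ) (z : ℝ) (hzR : 0 < zR) (hlam : 0 < lam) :
    rmax zR lam l z ^ 2 = (l.natAbs : ℝ) / 2 * spotSq zR lam z := by
  have := spot_pos_aux zR lam z hzR hlam
  unfold rmax
  rw [Real.sq_sqrt (by positivity)]

lemma spot_ratio_aux (zR a b z : ℝ) (hzR : 0 < zR) (hb : 0 < b) :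
    spotSq zR a z / spotSq zR b z = a / b := by
  have hb' := spot_pos_aux zR b z hzR hb
  rw [div_eq_div_iff hb'.ne' hb.ne']
  unfold spotSq waistSq
  ring

/-- Closed form of the gain, valid for every mode. -/
lemma gain_eq_aux (zR lamA : ℝ) (lm : ℤ) (hzR : 0 < zR) (hlamA : 0 < lamA)
    (lam : ℝ) (hlam : 0 < lam) (l : ℤ) (z β : ℝ) :
    gain zR lam l (β * rmax zR lamA lm z) z =
      lam ^ 2 / ((4 * Real.pi) ^ 2 *
        (waistSq zR lam * ((l.natAbs : ℝ) / 2) * (1 + z ^ 2 / zR ^ 2) + z ^ 2)) *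
      (β ^ 2 * (lm.natAbs : ℝ) * lamA / (l.natAbs : ℝ) / lam) ^ l.natAbs *
      Real.exp ((l.natAbs : ℝ) - β ^ 2 * (lm.natAbs : ℝ) * lamA / lam) := by
  have hS := spot_pos_aux zR lam z hzR hlam
  have hr := spot_ratio_aux zR lamA lam z hzR hlam
  have hA := rmax_sq_aux zR lamA lm z hzR hlamA
  have hL := rmax_sq_aux zR lam l z hzR hlam
  have hE : 2 * (β * rmax zR lamA lm z) ^ 2 / spotSq zR lam z
      = β ^ 2 * (lm.natAbs : ℝ) * lamA / lam := by
    rw [mul_pow, hA]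
    calc _ = β ^ 2 * (lm.natAbs : ℝ) * (spotSq zR lamA z / spotSq zR lam z) := by ring
      _ = _ := by rw [hr]; ring
  unfold gain
  split_ifs with h
  · subst h
    have : -2 * (β * rmax zR lamA lm z) ^ 2 / spotSq zR lam z
        = 0 - 2 * (β * rmax zR lamA lm z) ^ 2 / spotSq zR lam z := by ring
    rw [this, hE]
    simp
  · have hn : (0 : ℝ) < (l.natAbs : ℝ) := by
      exact_mod_cast Int.natAbs_pos.mpr h
    have hd : dm zR lam l z ^ 2
        = waistSq zR lam * ((l.natAbs : ℝ) / 2) * (1 + z ^ 2 / zR ^ 2) + z ^ 2 := by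
      unfold dm
      rw [Real.sq_sqrt (by positivity), hL]
      unfold spotSq
      ring
    have hx : 2 * (rmax zR lam l z ^ 2 - (β * rmax zR lamA lm z) ^ 2) / spotSq zR lam z
        = (l.natAbs : ℝ) - β ^ 2 * (lm.natAbs : ℝ) * lamA / lam := by
      rw [← hE, hL]
      field_simp
    have hp : (β * rmax zR lamA lm z / rmax zR lam l z) ^ 2
        = β ^ 2 * (lm.natAbs : ℝ) * lamA / (l.natAbs : ℝ) / lam := by
      rw [div_pow, mul_pow, hA, hL]
      calc _ = β ^ 2 * (lm.natAbs : ℝ) / (l.natAbs : ℝ) *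
            (spotSq zR lamA z / spotSq zR lam z) := by field_simp
        _ = _ := by rw [hr]; ring
    rw [hd, hx, pow_mul, hp]

/-- Equation (9): exact cross-wavelength, same-mode link gain ratio at position
`(β·r_max(λ_a, l_m, z), z)`. -/
theorem gain_ratio_cross_wavelength
    (zR lamA : ℝ) (lm : ℤ) (hzR : 0 < zR) (hlamA : 0 < lamA) (hlm : lm ≠ 0)
    (lamI lamJ : ℝ) (hlamI : 0 < lamI) (hlamJ : 0 < lamJ) (l : ℤ)
    (z β : ℝ) (hz : 0 < z) (hβ : 0 < β) :
    gain zR lamI l (β * rmax zR lamA lm z) z / gain zR lamJ l (β * rmax zR lamA lm z) z =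
      (lamJ / lamI) ^ ((l.natAbs : ℤ) - 2) *
        ((waistSq zR lamJ * ((l.natAbs : ℝ) / 2) * (1 + z ^ 2 / zR ^ 2) + z ^ 2) /
         (waistSq zR lamI * ((l.natAbs : ℝ) / 2) * (1 + z ^ 2 / zR ^ 2) + z ^ 2)) *
        Real.exp (β ^ 2 * (lm.natAbs : ℝ) * lamA * (lamI - lamJ) / (lamI * lamJ)) := by
  rw [gain_eq_aux zR lamA lm hzR hlamA lamI hlamI, gain_eq_aux zR lamA lm hzR hlamA lamJ hlamJ]
  have hpi := Real.pi_pos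
  have hD : ∀ lam : ℝ, 0 < lam →
      0 < waistSq zR lam * ((l.natAbs : ℝ) / 2) * (1 + z ^ 2 / zR ^ 2) + z ^ 2 := by
    intro lam h
    unfold waistSq
    positivity
  have hI := hD lamI hlamI
  have hJ := hD lamJ hlamJ
  have hK : (β ^ 2 * (lm.natAbs : ℝ) * lamA / (l.natAbs : ℝ)) ^ l.natAbs ≠ 0 := by
    by_cases h : l = 0
    · simp [h]
    · have h1 : (0 : ℝ) < (l.natAbs : ℝ) := by exact_mod_cast Int.natAbs_pos.mpr h
      have h2 : (0 : ℝ) < (lm.natAbs : ℝ) := by exact_mod_cast Int.natAbs_pos.mpr hlm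
      positivity
  have hexp : Real.exp (β ^ 2 * (lm.natAbs : ℝ) * lamA * (lamI - lamJ) / (lamI * lamJ))
      = Real.exp ((l.natAbs : ℝ) - β ^ 2 * (lm.natAbs : ℝ) * lamA / lamI) /
        Real.exp ((l.natAbs : ℝ) - β ^ 2 * (lm.natAbs : ℝ) * lamA / lamJ) := by
    rw [← Real.exp_sub]
    congr 1
    field_simp
    ring
  rw [hexp, zpow_sub₀ (by positivity), zpow_natCast, div_pow _ lamI, div_pow _ lamJ, div_pow lamJ]
  generalize (β ^ 2 * (lm.natAbs : ℝ) * lamA / (l.natAbs : ℝ)) ^ l.natAbs = K at *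
  generalize waistSq zR lamI * ((l.natAbs : ℝ) / 2) * (1 + z ^ 2 / zR ^ 2) + z ^ 2 = DI at *
  generalize waistSq zR lamJ * ((l.natAbs : ℝ) / 2) * (1 + z ^ 2 / zR ^ 2) + z ^ 2 = DJ at *
  have e1 := Real.exp_pos ((l.natAbs : ℝ) - β ^ 2 * (lm.natAbs : ℝ) * lamA / lamI)
  have e2 := Real.exp_pos ((l.natAbs : ℝ) - β ^ 2 * (lm.natAbs : ℝ) * lamA / lamJ)
  generalize Real.exp ((l.natAbs : ℝ) - β ^ 2 * (lm.natAbs : ℝ) * lamA / lamI) = EI at *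
  generalize Real.exp ((l.natAbs : ℝ) - β ^ 2 * (lm.natAbs : ℝ) * lamA / lamJ) = EJ at *
  have p1 : 0 < lamI ^ l.natAbs := by positivity
  have p2 : 0 < lamJ ^ l.natAbs := by positivity
  generalize lamI ^ l.natAbs = PI at *
  generalize lamJ ^ l.natAbs = PJ at *
  rw [zpow_ofNat]
  field_simp
end

section
/- Fix z_R > 0, λ_a > 0 and a nonzero mode l_m ∈ ℤ. For wavelengths λ_i, λ_j > 0, a mode l ∈ ℤ, a fixed z > 0 and β₁, β₂ > 0, write a_{i,j}^l(β, z) = g(λ_i, l, β·r_max(λ_a, l_m, z), z) / g(λ_j, l, β·r_max(λ_a, l_m, z), z). Then a_{i,j}^l(β₁, z) / a_{i,j}^l(β₂, z) = exp( |l_m|·λ_a·(λ_i − λ_j)/(λ_i·λ_j) · (β₁² − β₂²) ). In particular, the ratio equals 1 whenever β₁ = β₂. -/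
open scoped BigOperators

theorem spotSq_pos_aux {zR lam z : ℝ} (hzR : 0 < zR) (hlam : 0 < lam) : 0 < spotSq zR lam z := by
  unfold spotSq waistSq
  have := Real.pi_pos
  positivity

theorem rmax_pos_aux {zR lam z : ℝ} {l : ℤ} (hzR : 0 < zR) (hlam : 0 < lam) (hl : l ≠ 0) :
    0 < rmax zR lam l z := by
  unfold rmax
  have h1 := spotSq_pos_aux (z := z) hzR hlam
  have h2 : (0 : ℝ) < (l.natAbs : ℝ) := by exact_mod_cast Int.natAbs_pos.mpr hl
  positivity

theorem exponent_aux {zR lamA lam z β : ℝ} {lm : ℤ} (hzR : 0 < zR) (hlamA : 0 < lamA)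
    (hlam : 0 < lam) :
    -2 * (β * rmax zR lamA lm z) ^ 2 / spotSq zR lam z
      = -((lm.natAbs : ℝ) * lamA / lam * β ^ 2) := by
  have h1 := spotSq_pos_aux (z := z) hzR hlamA
  have h3 : spotSq zR lamA z = lamA / lam * spotSq zR lam z := by
    unfold spotSq waistSq
    field_simp
  have h4 := spotSq_pos_aux (z := z) hzR hlam
  rw [mul_pow, rmax, Real.sq_sqrt (by positivity), h3]
  field_simp

/-- The gain factors as a positive constant, a power of `β`, and a Gaussian in `β`. -/
theorem gain_factor_aux {zR lamA lam z : ℝ} {lm : ℤ} (l : ℤ) (hzR : 0 < zR) (hlamA : 0 < lamA)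
    (hlm : lm ≠ 0) (hlam : 0 < lam) (hz : 0 < z) :
    ∃ C : ℝ, 0 < C ∧ ∀ β : ℝ, gain zR lam l (β * rmax zR lamA lm z) z
      = C * β ^ (2 * l.natAbs) * Real.exp (-((lm.natAbs : ℝ) * lamA / lam * β ^ 2)) := by
  have hpi := Real.pi_pos
  by_cases hl : l = 0
  · refine ⟨lam ^ 2 / ((4 * Real.pi) ^ 2 * z ^ 2), by positivity, fun β => ?_⟩
    rw [gain, if_pos hl, exponent_aux hzR hlamA hlam]
    simp [hl]
  · have hr := rmax_pos_aux (z := z) hzR hlam hl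
    have hA := rmax_pos_aux (z := z) hzR hlamA hlm
    have hd : 0 < dm zR lam l z := by unfold dm; positivity
    refine ⟨lam ^ 2 / ((4 * Real.pi) ^ 2 * dm zR lam l z ^ 2) *
      (rmax zR lamA lm z / rmax zR lam l z) ^ (2 * l.natAbs) *
      Real.exp (2 * rmax zR lam l z ^ 2 / spotSq zR lam z), by positivity, fun β => ?_⟩
    have he : 2 * (rmax zR lam l z ^ 2 - (β * rmax zR lamA lm z) ^ 2) / spotSq zR lam z
        = 2 * rmax zR lam l z ^ 2 / spotSq zR lam z
          + -2 * (β * rmax zR lamA lm z) ^ 2 / spotSq zR lam z := by ring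
    rw [gain, if_neg hl, he, exponent_aux hzR hlamA hlam, Real.exp_add, mul_div_assoc, mul_pow]
    ring

/-- Equation (11), first identity: the same-mode cross-wavelength gain ratio
`a_{i,j}^l(β, z)` at two lateral positions `β₁, β₂` satisfies
`a(β₁)/a(β₂) = exp(|l_m|·λ_a·(λ_i − λ_j)/(λ_i·λ_j)·(β₁² − β₂²))`;
in particular it equals `1` whenever `β₁ = β₂`. -/
theorem gain_ratio_cross_wavelength_depends_only_on_beta
    (zR lamA : ℝ) (lm : ℤ) (hzR : 0 < zR) (hlamA : 0 < lamA) (hlm : lm ≠ 0)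
    (lamI lamJ : ℝ) (hlamI : 0 < lamI) (hlamJ : 0 < lamJ) (l : ℤ)
    (z β₁ β₂ : ℝ) (hz : 0 < z) (hβ₁ : 0 < β₁) (hβ₂ : 0 < β₂) :
    (gain zR lamI l (β₁ * rmax zR lamA lm z) z / gain zR lamJ l (β₁ * rmax zR lamA lm z) z) /
      (gain zR lamI l (β₂ * rmax zR lamA lm z) z / gain zR lamJ l (β₂ * rmax zR lamA lm z) z) =
      Real.exp ((lm.natAbs : ℝ) * lamA * (lamI - lamJ) / (lamI * lamJ) * (β₁ ^ 2 - β₂ ^ 2)) ∧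
    (β₁ = β₂ →
      (gain zR lamI l (β₁ * rmax zR lamA lm z) z / gain zR lamJ l (β₁ * rmax zR lamA lm z) z) /
        (gain zR lamI l (β₂ * rmax zR lamA lm z) z / gain zR lamJ l (β₂ * rmax zR lamA lm z) z)
        = 1) := by
  obtain ⟨C, hC, hI⟩ := gain_factor_aux (z := z) l hzR hlamA hlm hlamI hz
  obtain ⟨D, hD, hJ⟩ := gain_factor_aux (z := z) l hzR hlamA hlm hlamJ hz
  have key : (gain zR lamI l (β₁ * rmax zR lamA lm z) z /
        gain zR lamJ l (β₁ * rmax zR lamA lm z) z) /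
      (gain zR lamI l (β₂ * rmax zR lamA lm z) z / gain zR lamJ l (β₂ * rmax zR lamA lm z) z) =
      Real.exp ((lm.natAbs : ℝ) * lamA * (lamI - lamJ) / (lamI * lamJ) * (β₁ ^ 2 - β₂ ^ 2)) := by
    have hx : (lm.natAbs : ℝ) * lamA * (lamI - lamJ) / (lamI * lamJ) * (β₁ ^ 2 - β₂ ^ 2)
        = (-((lm.natAbs : ℝ) * lamA / lamI * β₁ ^ 2) - -((lm.natAbs : ℝ) * lamA / lamJ * β₁ ^ 2))
          - (-((lm.natAbs : ℝ) * lamA / lamI * β₂ ^ 2)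
            - -((lm.natAbs : ℝ) * lamA / lamJ * β₂ ^ 2)) := by
      field_simp
      ring
    rw [hx, Real.exp_sub, Real.exp_sub, Real.exp_sub, hI, hI, hJ, hJ]
    have h1 : 0 < β₁ ^ (2 * l.natAbs) := by positivity
    have h2 : 0 < β₂ ^ (2 * l.natAbs) := by positivity
    generalize β₁ ^ (2 * l.natAbs) = P at *
    generalize β₂ ^ (2 * l.natAbs) = Q at *
    rw [mul_div_mul_comm (C * P), mul_div_mul_comm (C * Q), mul_div_mul_right _ _ h1.ne',
      mul_div_mul_right _ _ h2.ne', mul_div_mul_left _ _ (div_pos hC hD).ne']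
  refine ⟨key, fun h => ?_⟩
  rw [key, h]
  simp
end

section
/- Fix z_R > 0, λ_a > 0, a nonzero mode l_m ∈ ℤ, a wavelength λ_i > 0 and a fixed z > 0. For a nonzero mode l ∈ ℤ, the map β ↦ g(λ_i, l, β·r_max(λ_a, l_m, z), z) is strictly increasing on (0, β*] and strictly decreasing on [β*, ∞), where β* = √(λ_i·|l| / (λ_a·|l_m|)); in particular β* is the unique maximizer over β > 0. For l = 0, the map β ↦ g(λ_i, 0, β·r_max(λ_a, l_m, z), z) is strictly decreasing on [0, ∞). -/
open scoped BigOperators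

lemma h_mono {s t : ℝ} (hs : 0 ≤ s) (hst : s < t) (ht : t ≤ 1) :
    s * Real.exp (1 - s) < t * Real.exp (1 - t) := by
  have h1 := Real.add_one_lt_exp (x := -(t - s)) (by linarith)
  have h2 : Real.exp (1 - t) = Real.exp (1 - s) * Real.exp (-(t - s)) := by
    rw [← Real.exp_add]; congr 1; ring
  have h3 : s < t * Real.exp (-(t - s)) := by
    nlinarith [mul_lt_mul_of_pos_left h1 (lt_of_le_of_lt hs hst),
      mul_nonneg (sub_nonneg.2 hst.le) (sub_nonneg.2 ht)]
  rw [h2]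
  nlinarith [mul_lt_mul_of_pos_left h3 (Real.exp_pos (1 - s))]

lemma h_anti {s t : ℝ} (hs : 1 ≤ s) (hst : s < t) :
    t * Real.exp (1 - t) < s * Real.exp (1 - s) := by
  have h1 := Real.add_one_lt_exp (x := t - s) (by linarith)
  have h2 : Real.exp (1 - s) = Real.exp (1 - t) * Real.exp (t - s) := by
    rw [← Real.exp_add]; congr 1; ring
  have h3 : t < s * Real.exp (t - s) := by
    nlinarith [mul_lt_mul_of_pos_left h1 (lt_of_lt_of_le one_pos hs),
      mul_nonneg (sub_nonneg.2 hst.le) (sub_nonneg.2 hs)]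
  rw [h2]
  nlinarith [mul_lt_mul_of_pos_left h3 (Real.exp_pos (1 - t))]

lemma spotSq_pos {zR lam : ℝ} (z : ℝ) (hzR : 0 < zR) (h : 0 < lam) : 0 < spotSq zR lam z := by
  unfold spotSq waistSq
  have := Real.pi_pos
  positivity

lemma rmax_pos {zR lam : ℝ} {l : ℤ} (z : ℝ) (hzR : 0 < zR) (h : 0 < lam) (hl : l ≠ 0) :
    0 < rmax zR lam l z := by
  have h1 := spotSq_pos z hzR h
  have h2 : (0 : ℝ) < l.natAbs := by exact_mod_cast Int.natAbs_pos.2 hl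
  unfold rmax
  positivity

/-- The gain profile in `β`: for a nonzero mode `l`, `β ↦ g(λ_i, l, β·r_max(λ_a,l_m,z), z)` is
strictly increasing on `(0, β*]` and strictly decreasing on `[β*, ∞)` with
`β* = √(λ_i|l|/(λ_a|l_m|))` the unique maximizer over `β > 0`; for mode `0` the gain is
strictly decreasing on `[0, ∞)`. -/
theorem gain_unimodal_in_beta
    (zR lamA : ℝ) (lm : ℤ) (hzR : 0 < zR) (hlamA : 0 < lamA) (hlm : lm ≠ 0)
    (lamI : ℝ) (hlamI : 0 < lamI) (z : ℝ) (hz : 0 < z)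
    (l : ℤ) (hl : l ≠ 0)
    (βstar : ℝ) (hβstar : βstar = Real.sqrt (lamI * (l.natAbs : ℝ) / (lamA * (lm.natAbs : ℝ)))) :
    StrictMonoOn (fun β => gain zR lamI l (β * rmax zR lamA lm z) z) (Set.Ioc 0 βstar) ∧
    StrictAntiOn (fun β => gain zR lamI l (β * rmax zR lamA lm z) z) (Set.Ici βstar) ∧
    (∀ β : ℝ, 0 < β → β ≠ βstar →
      gain zR lamI l (β * rmax zR lamA lm z) z < gain zR lamI l (βstar * rmax zR lamA lm z) z) ∧
    StrictAntiOn (fun β => gain zR lamI 0 (β * rmax zR lamA lm z) z) (Set.Ici 0) := by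
  have hn : (0 : ℝ) < l.natAbs := by exact_mod_cast Int.natAbs_pos.2 hl
  have hm : (0 : ℝ) < lm.natAbs := by exact_mod_cast Int.natAbs_pos.2 hlm
  have hb : 0 < βstar := by rw [hβstar]; positivity
  have hSI := spotSq_pos z hzR hlamI
  have hRA := rmax_pos z hzR hlamA hlm
  have hRI := rmax_pos z hzR hlamI hl
  have hrel : rmax zR lamI l z = βstar * rmax zR lamA lm z := by
    rw [hβstar]
    unfold rmax
    rw [← Real.sqrt_mul (by positivity)]
    congr 1
    unfold spotSq waistSq
    have := Real.pi_pos
    field_simp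
  have hsq : rmax zR lamI l z ^ 2 = (l.natAbs : ℝ) / 2 * spotSq zR lamI z := by
    unfold rmax
    exact Real.sq_sqrt (by positivity)
  obtain ⟨C, hC, hg⟩ : ∃ C : ℝ, 0 < C ∧ ∀ β : ℝ, gain zR lamI l (β * rmax zR lamA lm z) z =
      C * ((β / βstar) ^ 2 * Real.exp (1 - (β / βstar) ^ 2)) ^ l.natAbs := by
    refine ⟨lamI ^ 2 / ((4 * Real.pi) ^ 2 * dm zR lamI l z ^ 2), ?_, ?_⟩
    · have h1 : 0 < dm zR lamI l z := by unfold dm; positivity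
      have := Real.pi_pos
      positivity
    · intro β
      have hr : β * rmax zR lamA lm z = (β / βstar) * rmax zR lamI l z := by
        rw [hrel]; field_simp
      have he : 2 * (rmax zR lamI l z ^ 2 - ((β / βstar) * rmax zR lamI l z) ^ 2)
          / spotSq zR lamI z = (l.natAbs : ℝ) * (1 - (β / βstar) ^ 2) := by
        rw [mul_pow, hsq]; field_simp
      rw [gain, if_neg hl, hr, he, Real.exp_nat_mul, mul_div_cancel_right₀ _ hRI.ne',
        pow_mul, mul_assoc, ← mul_pow (_ ^ 2) (Real.exp _)]
  have hmono : StrictMonoOn (fun β => gain zR lamI l (β * rmax zR lamA lm z) z)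
      (Set.Ioc 0 βstar) := by
    rintro a ⟨ha, _⟩ b ⟨_, hb2⟩ hab
    simp only [hg]
    refine mul_lt_mul_of_pos_left (pow_lt_pow_left₀ (h_mono (by positivity) ?_ ?_)
      (by positivity) (Int.natAbs_ne_zero.2 hl)) hC
    · exact pow_lt_pow_left₀ (by gcongr) (by positivity) two_ne_zero
    · exact pow_le_one₀ (div_nonneg (by linarith) hb.le) ((div_le_one hb).2 hb2)
  have hanti : StrictAntiOn (fun β => gain zR lamI l (β * rmax zR lamA lm z) z)
      (Set.Ici βstar) := by
    intro a ha b _ hab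
    have ha' : βstar ≤ a := ha
    have ha0 : 0 < a := by linarith
    simp only [hg]
    refine mul_lt_mul_of_pos_left (pow_lt_pow_left₀ (h_anti ?_ ?_)
      (by positivity) (Int.natAbs_ne_zero.2 hl)) hC
    · exact one_le_pow₀ ((one_le_div hb).2 ha')
    · exact pow_lt_pow_left₀ (by gcongr) (by positivity) two_ne_zero
  refine ⟨hmono, hanti, ?_, ?_⟩
  · intro β h0 hne
    rcases lt_or_gt_of_ne hne with h | h
    · exact hmono ⟨h0, h.le⟩ ⟨hb, le_rfl⟩ h
    · exact hanti (Set.mem_Ici.2 le_rfl) (Set.mem_Ici.2 h.le) h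
  · intro a ha b _ hab
    have ha' : 0 ≤ a := ha
    have := Real.pi_pos
    simp only [gain, if_true]
    refine mul_lt_mul_of_pos_left (Real.exp_lt_exp.2 ?_) (by positivity)
    have h2 : (a * rmax zR lamA lm z) ^ 2 < (b * rmax zR lamA lm z) ^ 2 :=
      pow_lt_pow_left₀ (by gcongr) (by positivity) two_ne_zero
    exact div_lt_div_of_pos_right (by linarith) hSI
end

section
/- Fix z_R > 0, λ_a > 0, a nonzero mode l_m ∈ ℤ, a wavelength λ_i > 0, a nonzero mode l ∈ ℤ and z > 0. Let β* = √(λ_i·|l| / (λ_a·|l_m|)) and let 0 < Δβ < β*. Then a_r := g(λ_i, l, (β* + Δβ)·r_max(λ_a, l_m, z), z) / g(λ_i, l, (β* − Δβ)·r_max(λ_a, l_m, z), z) = ((β* + Δβ)/(β* − Δβ))^{2|l|} · exp( −4·(λ_a·|l_m|/λ_i)·Δβ·β* ). -/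
open scoped BigOperators

/-- Equation (14), exact closed form: the boundary-region gain ratio comparing equal lateral
displacements `Δβ` on the two sides of the maximum-gain radius `β* = √(λ_i|l|/(λ_a|l_m|))`. -/
theorem boundary_gain_ratio_closed_form
    (zR lamA : ℝ) (lm : ℤ) (hzR : 0 < zR) (hlamA : 0 < lamA) (hlm : lm ≠ 0)
    (lamI : ℝ) (hlamI : 0 < lamI) (l : ℤ) (hl : l ≠ 0) (z : ℝ) (hz : 0 < z)
    (βstar : ℝ) (hβstar : βstar = Real.sqrt (lamI * (l.natAbs : ℝ) / (lamA * (lm.natAbs : ℝ))))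
    (Δβ : ℝ) (hΔβ : 0 < Δβ) (hΔβlt : Δβ < βstar) :
    gain zR lamI l ((βstar + Δβ) * rmax zR lamA lm z) z /
      gain zR lamI l ((βstar - Δβ) * rmax zR lamA lm z) z =
      ((βstar + Δβ) / (βstar - Δβ)) ^ (2 * l.natAbs) *
        Real.exp (-4 * (lamA * (lm.natAbs : ℝ) / lamI) * Δβ * βstar) := by
  have hspot : ∀ lam : ℝ, 0 < lam → 0 < spotSq zR lam z := by
    intro lam h
    unfold spotSq waistSq
    have := Real.pi_pos
    positivity
  have hn : ∀ k : ℤ, k ≠ 0 → (0 : ℝ) < (k.natAbs : ℝ) := by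
    intro k hk
    exact_mod_cast Int.natAbs_pos.mpr hk
  have hrpos : ∀ (lam : ℝ) (k : ℤ), 0 < lam → k ≠ 0 → 0 < rmax zR lam k z := by
    intro lam k h hk
    have h1 := hspot lam h
    have h2 := hn k hk
    unfold rmax
    positivity
  have hrA := hrpos lamA lm hlamA hlm
  have hrI := hrpos lamI l hlamI hl
  have hsI := hspot lamI hlamI
  have hsq : rmax zR lamA lm z ^ 2 = (lm.natAbs : ℝ) / 2 * (lamA / lamI * spotSq zR lamI z) := by
    have h1 := hspot lamA hlamA
    have h2 := hn lm hlm
    unfold rmax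
    rw [Real.sq_sqrt (by positivity)]
    unfold spotSq waistSq
    field_simp
  have hdm : 0 < dm zR lamI l z := by
    unfold dm
    positivity
  have hm : 0 < βstar - Δβ := by linarith
  have hpi := Real.pi_pos
  unfold gain
  rw [if_neg hl, if_neg hl, mul_div_mul_comm, mul_div_mul_comm, ← Real.exp_sub, ← div_pow,
    div_self (by positivity), one_mul]
  congr 1
  · congr 1
    field_simp
  · congr 1
    rw [mul_pow, mul_pow, hsq]
    field_simp
    ring
end

section
/- Let n ≥ 1, let n₀ = 2n (so polynomial degree 2|l| with |l| = n ≥ 1), let c > 0 and set β₀ = √(n/c). For every 0 < Δ < β₀, ((β₀ + Δ)/(β₀ − Δ))^{2n} · exp(−4·c·Δ·β₀) > 1; equivalently, (β₀ + Δ)^{2n}·exp(−c·(β₀ + Δ)²) > (β₀ − Δ)^{2n}·exp(−c·(β₀ − Δ)²). -/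
/-- `2x < log (1+x) - log (1-x)` in exponential form. -/
theorem exp_two_mul_lt_ratio (x : ℝ) (h0 : 0 < x) (h1 : x < 1) :
    Real.exp (2 * x) < (1 + x) / (1 - x) := by
  have hs := Real.hasSum_log_sub_log_of_abs_lt_one (x := x) (by rw [abs_of_pos h0]; exact h1)
  have h := sum_le_hasSum (Finset.range 2) (fun i _ => by positivity) hs
  simp only [Finset.sum_range_succ, Finset.sum_range_zero] at h
  norm_num at h
  have hx3 : 0 < x ^ 3 := by positivity
  have h2 : (0:ℝ) < 1 - x := by linarith
  rw [← Real.lt_log_iff_exp_lt (by positivity), Real.log_div (by positivity) h2.ne']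
  linarith

/-- Analytic core of the boundary asymmetry claim: for `f(β) = β^{2n}·e^{−c·β²}` with maximizer
`β₀ = √(n/c)`, the profile decays faster on the left of its maximum than on the right, i.e.
`((β₀+Δ)/(β₀−Δ))^{2n}·exp(−4·c·Δ·β₀) > 1`, equivalently `f(β₀+Δ) > f(β₀−Δ)`, for `0 < Δ < β₀`. -/
theorem gain_profile_asymmetry
    (n : ℕ) (hn : 1 ≤ n) (c : ℝ) (hc : 0 < c)
    (β₀ : ℝ) (hβ₀ : β₀ = Real.sqrt ((n : ℝ) / c))
    (Δ : ℝ) (hΔ : 0 < Δ) (hΔβ : Δ < β₀) :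
    1 < ((β₀ + Δ) / (β₀ - Δ)) ^ (2 * n) * Real.exp (-4 * c * Δ * β₀) ∧
    (β₀ - Δ) ^ (2 * n) * Real.exp (-c * (β₀ - Δ) ^ 2) <
      (β₀ + Δ) ^ (2 * n) * Real.exp (-c * (β₀ + Δ) ^ 2) := by
  have hb : 0 < β₀ := hΔ.trans hΔβ
  have hd : 0 < β₀ - Δ := by linarith
  have hsq : c * β₀ ^ 2 = n := by
    rw [hβ₀, Real.sq_sqrt (by positivity)]
    field_simp
  have hx := exp_two_mul_lt_ratio (Δ / β₀) (by positivity) ((div_lt_one hb).2 hΔβ)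
  have hr : (1 + Δ / β₀) / (1 - Δ / β₀) = (β₀ + Δ) / (β₀ - Δ) := by
    have h1 : 1 + Δ / β₀ = (β₀ + Δ) / β₀ := by field_simp
    have h2 : 1 - Δ / β₀ = (β₀ - Δ) / β₀ := by field_simp
    rw [h1, h2, div_div_div_cancel_right₀ hb.ne']
  rw [hr] at hx
  have hp := pow_lt_pow_left₀ hx (Real.exp_pos _).le (show 2 * n ≠ 0 by omega)
  have he : Real.exp (2 * (Δ / β₀)) ^ (2 * n) = Real.exp (4 * c * Δ * β₀) := by
    rw [← Real.exp_nat_mul]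
    congr 1
    push_cast
    rw [← hsq]
    field_simp
    ring
  rw [he] at hp
  constructor
  · calc (1:ℝ) = Real.exp (4 * c * Δ * β₀) * Real.exp (-4 * c * Δ * β₀) := by
          rw [← Real.exp_add, ← Real.exp_zero]
          congr 1
          ring
      _ < _ := mul_lt_mul_of_pos_right hp (Real.exp_pos _)
  · rw [div_pow, lt_div_iff₀ (by positivity)] at hp
    have hE : Real.exp (-c * (β₀ - Δ) ^ 2)
        = Real.exp (4 * c * Δ * β₀) * Real.exp (-c * (β₀ + Δ) ^ 2) := by
      rw [← Real.exp_add]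
      congr 1
      ring
    rw [hE]
    calc _ = Real.exp (4 * c * Δ * β₀) * (β₀ - Δ) ^ (2 * n) * Real.exp (-c * (β₀ + Δ) ^ 2) := by
          ring
      _ < _ := mul_lt_mul_of_pos_right hp (Real.exp_pos _)
end
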